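/- There exists an absolute constant K ≥ 1 such that for every β ≥ 1 there are a constant c_β > 0 and infinitely many d for which there is an MLIJ instance on d machines with feasible set D satisfying: (i) there exists X ⊆ D with |X| = 2 that is a K-approximate portfolio for the class of all top-k norms (k = 1,…,d) over D; and (ii) every X' ⊆ D that is a β-approximate portfolio for the class of all ordered norms over D satisfies |X'| ≥ c_β·log d / log log d. -/

import Mathlib

/-- The vector of absolute values of the coordinates of `x`, sorted in decreasing order. -/
noncomputable def absSortDesc {d : ℕ} (x : Fin d → ℝ) : Fin d → ℝ :=
  fun k => |x (Tuple.sort (fun i => |x i|) k.rev)|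

/-- The ordered norm `‖x‖_(w) = Σ_k w_k (|x|↓)_k`. -/
noncomputable def orderedNorm {d : ℕ} (w x : Fin d → ℝ) : ℝ :=
  ∑ k, w k * absSortDesc x k

/-- The top-`k` norm: the sum of the `k` largest coordinates of `|x|`. -/
noncomputable def topkNorm {d : ℕ} (k : ℕ) (x : Fin d → ℝ) : ℝ :=
  ∑ i ∈ Finset.univ.filter (fun i : Fin d => (i : ℕ) < k), absSortDesc x i

/-- A weight vector: nonincreasing, nonnegative, nonzero. -/
def IsWeightVector {d : ℕ} (w : Fin d → ℝ) : Prop :=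
  Antitone w ∧ (∀ k, 0 ≤ w k) ∧ w ≠ 0

/-- A symmetric monotonic norm on `ι → ℝ`. -/
def IsSymMonotoneNorm {ι : Type*} [Fintype ι] (f : (ι → ℝ) → ℝ) : Prop :=
  (∀ x, f x = 0 ↔ x = 0) ∧
  (∀ (a : ℝ) (x : ι → ℝ), f (a • x) = |a| * f x) ∧
  (∀ x y : ι → ℝ, f (x + y) ≤ f x + f y) ∧
  (∀ (σ : Equiv.Perm ι) (x : ι → ℝ), f (x ∘ σ) = f x) ∧
  (∀ x y : ι → ℝ, (∀ i, 0 ≤ x i) → (∀ i, x i ≤ y i) → f x ≤ f y)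

/-- Feasible load vectors of the Machine-Loads-Identical-Jobs problem. -/
def MLIJ {d : ℕ} (p : Fin d → ℝ) (n : ℕ) : Set (Fin d → ℝ) :=
  { x | ∃ m : Fin d → ℕ, (∑ i, m i) = n ∧ ∀ i, x i = (m i : ℝ) * p i }

/-- The dual of the ordered norm. -/
noncomputable def dualOrderedNorm {d : ℕ} (w y : Fin d → ℝ) : ℝ :=
  sSup { r : ℝ | ∃ x : Fin d → ℝ, orderedNorm w x ≤ 1 ∧ r = ∑ i, y i * x i }

/-- The coordinates of `x` sorted in increasing order. -/
noncomputable def sortAsc {n : ℕ} (x : Fin n → ℝ) : Fin n → ℝ :=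
  fun k => x (Tuple.sort x k)

/-- Distance vector induced by a set of open facilities. -/
noncomputable def distVec {X : Type*} [MetricSpace X] (F : Finset X) : X → ℝ :=
  fun j => sInf ((fun c => dist j c) '' (F : Set X))

/-- `x(l)`: the vector with the first `l+1` coordinates (indices `≤ l`) equal to
`n / Σ_{j ≤ l} 1/p_j` and zero elsewhere. -/
noncomputable def vertexX {d : ℕ} (p : Fin d → ℝ) (n : ℝ) (l : Fin d) : Fin d → ℝ :=
  fun i => if i ≤ l then n / (∑ j ∈ Finset.univ.filter (fun j : Fin d => j ≤ l), 1 / p j) else 0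

/-- Completion time of job `j` when job `j'` is assigned to machine `a j'` and jobs are
processed on each machine in the order induced by the priority permutation `π`. -/
noncomputable def completionTime {n d : ℕ} (p : Fin d → Fin n → ℝ)
    (a : Fin n → Fin d) (π : Equiv.Perm (Fin n)) : Fin n → ℝ :=
  fun j => ∑ j' ∈ Finset.univ.filter (fun j' : Fin n => a j' = a j ∧ π j' ≤ π j), p (a j) j'

/-- A tour on `n` vertices starting at `v₀`: `τ 0 = v₀` and `τ` is a bijection from
`{0, …, n-1}` onto the vertex set. -/
def IsTour {V : Type*} (n : ℕ) (v₀ : V) (τ : ℕ → V) : Prop :=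
  τ 0 = v₀ ∧ Set.BijOn τ (Set.Iio n) Set.univ

/-- The visit times of the vertices `τ 0, …, τ (n-1)` of a tour. -/
noncomputable def tourVisitTimes {V : Type*} [MetricSpace V] (n : ℕ) (τ : ℕ → V) : Fin n → ℝ :=
  fun i => ∑ j ∈ Finset.range (i : ℕ), dist (τ j) (τ (j + 1))

/-- Cover time of element `e` under the ordering `π` of the subsets `S 0, …, S (m-1)`:
the position (in `{1, …, m}`) of the first subset containing `e`. -/
noncomputable def coverTime {n m : ℕ} (S : Fin m → Finset (Fin n))
    (π : Equiv.Perm (Fin m)) (e : Fin n) : ℕ :=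
  1 + sInf {t : ℕ | ∃ h : t < m, e ∈ S (π ⟨t, h⟩)}

open Finset in
/-- Machines split into groups `0, …, L - 1`, group `j` having `N j` members. -/
theorem exists_grouping (N : ℕ → ℕ) (L : ℕ) :
    ∃ (d : ℕ) (g : Fin d → ℕ), (∀ i, g i < L) ∧
      ∀ f : ℕ → ℝ, ∑ i, f (g i) = ∑ j ∈ range L, (N j : ℝ) * f j := by
  let e := (Fintype.equivFin (Σ j : Fin L, Fin (N j))).symm
  refine ⟨_, fun i => ((e i).1 : ℕ), fun i => (e i).1.2, fun f => ?_⟩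
  rw [Equiv.sum_comp e (fun x => f (x.1 : ℕ)), Fintype.sum_sigma,
    ← Fin.sum_univ_eq_sum_range (fun j => (N j : ℝ) * f j) L]
  simp

theorem absSortDesc_antitone {d : ℕ} (x : Fin d → ℝ) : Antitone (absSortDesc x) := by
  intro a b h
  exact Tuple.monotone_sort (fun i => |x i|) (Fin.rev_le_rev.mpr h)

theorem absSortDesc_nonneg {d : ℕ} (x : Fin d → ℝ) (k : Fin d) : 0 ≤ absSortDesc x k :=
  abs_nonneg _

/-- `absSortDesc x` is a rearrangement of `|x|`. -/
theorem exists_perm_absSortDesc {d : ℕ} (x : Fin d → ℝ) :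
    ∃ σ : Equiv.Perm (Fin d), ∀ k, absSortDesc x k = |x (σ k)| :=
  ⟨Fin.revPerm.trans (Tuple.sort fun i => |x i|), fun _ => rfl⟩

theorem sum_absSortDesc {d : ℕ} (x : Fin d → ℝ) : ∑ k, absSortDesc x k = ∑ i, |x i| := by
  obtain ⟨σ, hσ⟩ := exists_perm_absSortDesc x
  simp only [hσ]
  exact Equiv.sum_comp σ fun i => |x i|

theorem topkNorm_le_sum {d : ℕ} (k : ℕ) (x : Fin d → ℝ) : topkNorm k x ≤ ∑ i, |x i| := by
  rw [← sum_absSortDesc]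
  exact Finset.sum_le_sum_of_subset_of_nonneg (Finset.filter_subset _ _)
    fun i _ _ => absSortDesc_nonneg x i

theorem card_filter_val_lt {d k : ℕ} (hk : k ≤ d) :
    (Finset.univ.filter fun i : Fin d => (i : ℕ) < k).card = k := by
  simp [Fin.card_filter_val_lt, hk]

theorem topkNorm_const {d k : ℕ} (hk : k ≤ d) {t : ℝ} (ht : 0 ≤ t) :
    topkNorm k (fun _ : Fin d => t) = k * t := by
  simp [topkNorm, absSortDesc, abs_of_nonneg ht, card_filter_val_lt hk]

/-- Duality bound for the top-`k` norm against coefficients in `[0, 1]`. -/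
theorem sum_mul_le_topkNorm {d k : ℕ} (hk : 1 ≤ k) (hkd : k ≤ d) (q x : Fin d → ℝ)
    (hq0 : ∀ i, 0 ≤ q i) (hq1 : ∀ i, q i ≤ 1) :
    (∑ i, |x i| * q i ≤ topkNorm k x) ∨
      ((k : ℝ) * ∑ i, |x i| * q i ≤ topkNorm k x * ∑ i, q i) := by
  obtain ⟨σ, hσ⟩ := exists_perm_absSortDesc x
  set a := absSortDesc x with ha
  set τ := a ⟨k - 1, by omega⟩ with hτ
  have hτ0 : 0 ≤ τ := absSortDesc_nonneg x _
  have hge : ∀ i : Fin d, (i : ℕ) < k → τ ≤ a i := fun i hi =>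
    absSortDesc_antitone x (Fin.le_def.mpr (by simp; omega))
  have hle : ∀ i : Fin d, ¬ (i : ℕ) < k → a i ≤ τ := fun i hi =>
    absSortDesc_antitone x (Fin.le_def.mpr (by simp; omega))
  have hsum : ∑ i, |x i| * q i = ∑ i, a i * q (σ i) := by
    simp only [hσ]
    exact (Equiv.sum_comp σ fun i => |x i| * q i).symm
  have hqs : ∑ i, q (σ i) = ∑ i, q i := Equiv.sum_comp σ q
  have htop : ∑ i : Fin d, (if (i : ℕ) < k then a i - τ else 0) = topkNorm k x - k * τ := by
    rw [← Finset.sum_filter, Finset.sum_sub_distrib, Finset.sum_const, card_filter_val_lt hkd,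
      nsmul_eq_mul]
    rfl
  have hkτ : 0 ≤ topkNorm k x - k * τ := by
    rw [← htop]
    refine Finset.sum_nonneg fun i _ => ?_
    split_ifs with h
    · linarith [hge i h]
    · rfl
  have hbound : ∑ i, |x i| * q i ≤ (topkNorm k x - k * τ) + τ * ∑ i, q i := by
    rw [hsum, ← htop, ← hqs, Finset.mul_sum, ← Finset.sum_add_distrib]
    refine Finset.sum_le_sum fun i _ => ?_
    split_ifs with h
    · nlinarith [hge i h, hq1 (σ i)]
    · nlinarith [hle i h, hq0 (σ i)]
  have hk0 : (0 : ℝ) < k := by exact_mod_cast hk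
  rcases le_total (∑ i, q i) k with h | h
  · left
    nlinarith
  · right
    nlinarith [mul_nonneg hkτ (sub_nonneg.mpr h)]

/-- The weights of the norm `T ‖x‖_∞ + ‖x‖_1`. -/
def spikeWeight (d : ℕ) (T : ℝ) : Fin d → ℝ := fun k => if (k : ℕ) = 0 then T + 1 else 1

theorem isWeightVector_spikeWeight {d : ℕ} (hd : 0 < d) {T : ℝ} (hT : 0 ≤ T) :
    IsWeightVector (spikeWeight d T) := by
  refine ⟨fun a b h => ?_, fun k => ?_, fun h => ?_⟩
  · have := Fin.le_def.mp h
    simp only [spikeWeight]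
    split_ifs <;> first | omega | linarith
  · simp only [spikeWeight]
    split_ifs <;> linarith
  · have := congrFun h ⟨0, hd⟩
    simp [spikeWeight] at this
    linarith

theorem orderedNorm_spikeWeight {d : ℕ} (hd : 0 < d) (T : ℝ) (x : Fin d → ℝ) :
    orderedNorm (spikeWeight d T) x = T * absSortDesc x ⟨0, hd⟩ + ∑ i, |x i| := by
  rw [← sum_absSortDesc, orderedNorm]
  have h : ∀ k : Fin d, spikeWeight d T k * absSortDesc x k =
      (if k = ⟨0, hd⟩ then T * absSortDesc x k else 0) + absSortDesc x k := by
    intro k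
    by_cases hk : k = ⟨0, hd⟩
    · subst hk; simp [spikeWeight]; ring
    · have : (k : ℕ) ≠ 0 := fun h => hk (Fin.ext h)
      simp [spikeWeight, hk, this]
  simp [h, Finset.sum_add_distrib]

theorem abs_le_absSortDesc_zero {d : ℕ} (hd : 0 < d) (x : Fin d → ℝ) (i : Fin d) :
    |x i| ≤ absSortDesc x ⟨0, hd⟩ := by
  obtain ⟨σ, hσ⟩ := exists_perm_absSortDesc x
  have := absSortDesc_antitone x (a := ⟨0, hd⟩) (b := σ.symm i) (Fin.le_def.mpr (Nat.zero_le _))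
  rwa [hσ (σ.symm i), σ.apply_symm_apply] at this

theorem absSortDesc_le {d : ℕ} (x : Fin d → ℝ) {M : ℝ} (h : ∀ i, |x i| ≤ M) (k : Fin d) :
    absSortDesc x k ≤ M :=
  h _

theorem MLIJ_finite {d : ℕ} (p : Fin d → ℝ) (n : ℕ) : (MLIJ p n).Finite := by
  refine ((Set.finite_Iic (fun _ : Fin d => n)).image fun m i => (m i : ℝ) * p i).subset ?_
  rintro x ⟨m, hm, hx⟩
  exact ⟨m, fun i => hm ▸ Finset.single_le_sum (fun _ _ => Nat.zero_le _) (Finset.mem_univ i),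
    (funext hx).symm⟩

/-- If `x` is a good solution for `s^(2l) ‖x‖_∞ + ‖x‖_1`, most jobs run in group `l`. -/
theorem majority_in_group {d L s l n : ℕ} {β : ℝ} (hβ : 1 ≤ β) (hs : 16 * β + 1 ≤ s)
    (hd : 0 < d) (hl : l < L) (hn : 1 ≤ n) (g : Fin d → ℕ)
    (hsum : ∀ f : ℕ → ℝ, ∑ i, f (g i) = ∑ j ∈ Finset.range L, ((s ^ (2 * j) : ℕ) : ℝ) * f j)
    (m : Fin d → ℕ) (hm : ∑ i, m i = n) (x : Fin d → ℝ)
    (hx : ∀ i, x i = (m i : ℝ) * (s : ℝ) ^ g i)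
    (hle : orderedNorm (spikeWeight d ((s : ℝ) ^ (2 * l))) x ≤ 2 * β * n * (s : ℝ) ^ l) :
    (n : ℝ) / 2 < ∑ i, if g i = l then (m i : ℝ) else 0 := by
  have hs0 : (0 : ℝ) < s := by linarith
  have hn0 : (1 : ℝ) ≤ n := by exact_mod_cast hn
  have hx0 : ∀ i, |x i| = (m i : ℝ) * (s : ℝ) ^ g i := fun i => by
    rw [hx, abs_of_nonneg (by positivity)]
  rw [orderedNorm_spikeWeight hd] at hle
  set a := absSortDesc x ⟨0, hd⟩ with ha
  have ha0 : 0 ≤ a := absSortDesc_nonneg x _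
  have hl0 : (0 : ℝ) < (s : ℝ) ^ l := by positivity
  have hsumx0 : 0 ≤ ∑ i, |x i| := Finset.sum_nonneg fun i _ => abs_nonneg _
  have hA : (∑ i, if l < g i then (m i : ℝ) else 0) * s ≤ 2 * β * n := by
    have h1 : (∑ i, if l < g i then (m i : ℝ) else 0) * s * (s : ℝ) ^ l ≤ ∑ i, |x i| := by
      rw [mul_assoc, Finset.sum_mul]
      refine Finset.sum_le_sum fun i _ => ?_
      rw [hx0]
      split_ifs with h
      · rw [← pow_succ']
        have : (s : ℝ) ^ (l + 1) ≤ (s : ℝ) ^ g i := pow_le_pow_right₀ (by linarith) h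
        gcongr
      · rw [zero_mul]; positivity
    have h2 : 0 ≤ (s : ℝ) ^ (2 * l) * a := by positivity
    exact le_of_mul_le_mul_right (by linarith) hl0
  have hB : (∑ i, if g i < l then (m i : ℝ) else 0) * (s - 1) ≤ 2 * β * n := by
    have h1 : (∑ i, if g i < l then (m i : ℝ) else 0) ≤
        a * ∑ i, if g i < l then ((s : ℝ) ^ g i)⁻¹ else 0 := by
      rw [Finset.mul_sum]
      refine Finset.sum_le_sum fun i _ => ?_
      split_ifs with h
      · rw [← div_eq_mul_inv, le_div_iff₀ (by positivity), ← hx0]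
        exact abs_le_absSortDesc_zero hd x i
      · simp
    have h2 : (∑ i, if g i < l then ((s : ℝ) ^ g i)⁻¹ else 0) =
        ∑ j ∈ Finset.range l, (s : ℝ) ^ j := by
      rw [hsum fun j => if j < l then ((s : ℝ) ^ j)⁻¹ else 0]
      rw [← Finset.sum_subset (Finset.range_subset_range.mpr hl.le)]
      · refine Finset.sum_congr rfl fun j hj => ?_
        rw [if_pos (Finset.mem_range.mp hj)]
        push_cast
        field_simp
        ring
      · intro j _ hj
        rw [if_neg (by simpa using hj), mul_zero]
    have h3 := geom_sum_mul (s : ℝ) l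
    have h4 : a * (s : ℝ) ^ l ≤ 2 * β * n := by
      refine le_of_mul_le_mul_right ?_ hl0
      rw [mul_assoc, ← pow_add, ← two_mul]
      linarith
    rw [h2] at h1
    calc _ ≤ (a * ∑ j ∈ Finset.range l, (s : ℝ) ^ j) * (s - 1) := by
          gcongr; linarith
      _ = a * ((s : ℝ) ^ l - 1) := by rw [mul_assoc, h3]
      _ ≤ _ := by linarith
  have htot : (∑ i, if g i = l then (m i : ℝ) else 0) + (∑ i, if l < g i then (m i : ℝ) else 0) +
      (∑ i, if g i < l then (m i : ℝ) else 0) = n := by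
    rw [← hm, Nat.cast_sum, ← Finset.sum_add_distrib, ← Finset.sum_add_distrib]
    refine Finset.sum_congr rfl fun i _ => ?_
    rcases lt_trichotomy (g i) l with h | h | h
    · simp [h, h.ne, h.le.not_gt]
    · simp [h]
    · simp [h, h.ne', h.le.not_gt]
  have hA0 : 0 ≤ ∑ i, if l < g i then (m i : ℝ) else 0 :=
    Finset.sum_nonneg fun i _ => by split_ifs <;> positivity
  have hB0 : 0 ≤ ∑ i, if g i < l then (m i : ℝ) else 0 :=
    Finset.sum_nonneg fun i _ => by split_ifs <;> positivity
  have hA' : (∑ i, if l < g i then (m i : ℝ) else 0) * 8 ≤ n := by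
    refine le_of_mul_le_mul_right (a := 2 * β) ?_ (by linarith)
    nlinarith
  have hB' : (∑ i, if g i < l then (m i : ℝ) else 0) * 8 ≤ n := by
    refine le_of_mul_le_mul_right (a := 2 * β) ?_ (by linarith)
    nlinarith
  linarith

/-- Two groups cannot both receive more than half of the jobs. -/
theorem majority_unique {d n l l' : ℕ} (g : Fin d → ℕ) (m : Fin d → ℕ) (hm : ∑ i, m i = n)
    (h : (n : ℝ) / 2 < ∑ i, if g i = l then (m i : ℝ) else 0)
    (h' : (n : ℝ) / 2 < ∑ i, if g i = l' then (m i : ℝ) else 0) : l = l' := by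
  by_contra hne
  have : (∑ i, if g i = l then (m i : ℝ) else 0) + (∑ i, if g i = l' then (m i : ℝ) else 0) ≤ n := by
    rw [← hm, Nat.cast_sum, ← Finset.sum_add_distrib]
    refine Finset.sum_le_sum fun i _ => ?_
    split_ifs with h1 h2
    · exact absurd (h1.symm.trans h2) hne
    all_goals simp
  linarith

/-- Spreading the jobs evenly over group `l`. -/
theorem exists_group_solution {d L s l : ℕ} (hs : 1 ≤ s) (hd : 0 < d) (hl : l < L) (Q : ℕ)
    (g : Fin d → ℕ)
    (hsum : ∀ f : ℕ → ℝ, ∑ i, f (g i) = ∑ j ∈ Finset.range L, ((s ^ (2 * j) : ℕ) : ℝ) * f j) :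
    ∃ y ∈ MLIJ (fun i => (s : ℝ) ^ g i) (s ^ (2 * L) * Q),
      orderedNorm (spikeWeight d ((s : ℝ) ^ (2 * l))) y ≤
        2 * ((s ^ (2 * L) * Q : ℕ) : ℝ) * (s : ℝ) ^ l := by
  have hs0 : (0 : ℝ) < s := by exact_mod_cast hs
  have hpow : (s : ℝ) ^ (2 * l) * (s : ℝ) ^ (2 * (L - l)) = (s : ℝ) ^ (2 * L) := by
    rw [← pow_add]; congr 1; omega
  let m : Fin d → ℕ := fun i => if g i = l then s ^ (2 * (L - l)) * Q else 0
  have hy : ∀ i, |(m i : ℝ) * (s : ℝ) ^ g i| =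
      if g i = l then (s : ℝ) ^ (2 * (L - l)) * Q * (s : ℝ) ^ l else 0 := by
    intro i
    rw [abs_of_nonneg (by positivity)]
    by_cases h : g i = l <;> simp [m, h]
  refine ⟨fun i => (m i : ℝ) * (s : ℝ) ^ g i, ⟨m, ?_, fun i => rfl⟩, ?_⟩
  · have := hsum fun j => if j = l then (s : ℝ) ^ (2 * (L - l)) * Q else 0
    simp only [mul_ite, mul_zero, Finset.sum_ite_eq', Finset.mem_range, hl, if_true] at this
    rw [← @Nat.cast_inj ℝ]
    push_cast [m]
    rw [this]
    push_cast
    rw [← mul_assoc, hpow]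
  · rw [orderedNorm_spikeWeight hd]
    have h1 := hsum fun j => if j = l then (s : ℝ) ^ (2 * (L - l)) * Q * (s : ℝ) ^ l else 0
    simp only [mul_ite, mul_zero, Finset.sum_ite_eq', Finset.mem_range, hl, if_true] at h1
    simp only [hy, h1]
    have h2 : absSortDesc (fun i => (m i : ℝ) * (s : ℝ) ^ g i) ⟨0, hd⟩ ≤
        (s : ℝ) ^ (2 * (L - l)) * Q * (s : ℝ) ^ l := by
      refine absSortDesc_le _ (fun i => ?_) _
      rw [hy]
      split_ifs
      · rfl
      · positivity
    have h3 := mul_le_mul_of_nonneg_left h2 (pow_nonneg hs0.le (2 * l))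
    push_cast
    rw [← hpow]
    linarith

/-- Every portfolio for the ordered norms has at least one member per group. -/
theorem le_ncard_portfolio {d L s Q : ℕ} {β : ℝ} (hβ : 1 ≤ β) (hs : 16 * β + 1 ≤ s)
    (hd : 0 < d) (hQ : 1 ≤ Q) (g : Fin d → ℕ)
    (hsum : ∀ f : ℕ → ℝ, ∑ i, f (g i) = ∑ j ∈ Finset.range L, ((s ^ (2 * j) : ℕ) : ℝ) * f j)
    (X : Set (Fin d → ℝ)) (hX : X ⊆ MLIJ (fun i => (s : ℝ) ^ g i) (s ^ (2 * L) * Q))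
    (hport : ∀ w : Fin d → ℝ, IsWeightVector w →
      ∀ y ∈ MLIJ (fun i => (s : ℝ) ^ g i) (s ^ (2 * L) * Q),
        ∃ x ∈ X, orderedNorm w x ≤ β * orderedNorm w y) :
    L ≤ X.ncard := by
  have hs1 : 1 ≤ s := by
    have : (1 : ℝ) ≤ s := by linarith
    exact_mod_cast this
  have hn : 1 ≤ s ^ (2 * L) * Q := Nat.mul_pos (by positivity) hQ
  have hex : ∀ l : Fin L, ∃ x ∈ X, orderedNorm (spikeWeight d ((s : ℝ) ^ (2 * (l : ℕ)))) x ≤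
      2 * β * ((s ^ (2 * L) * Q : ℕ) : ℝ) * (s : ℝ) ^ (l : ℕ) := by
    intro l
    obtain ⟨y, hy, hyn⟩ := exists_group_solution hs1 hd l.2 Q g hsum
    obtain ⟨x, hxX, hx⟩ := hport _ (isWeightVector_spikeWeight hd
      (by positivity : (0 : ℝ) ≤ (s : ℝ) ^ (2 * (l : ℕ)))) y hy
    refine ⟨x, hxX, hx.trans ?_⟩
    have := mul_le_mul_of_nonneg_left hyn (by linarith : (0 : ℝ) ≤ β)
    linarith
  choose F hFX hF using hex
  have hinj : Function.Injective F := by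
    intro l l' h
    obtain ⟨m, hm, hx⟩ := hX (hFX l)
    refine Fin.ext (majority_unique g m hm
      (majority_in_group hβ hs hd l.2 hn g hsum m hm _ hx (hF l))
      (majority_in_group hβ hs hd l'.2 hn g hsum m hm _ hx ?_))
    rw [h]
    exact hF l'
  calc L = (Set.range F).ncard := by
        rw [← Set.image_univ, Set.ncard_image_of_injective _ hinj, Set.ncard_univ]; simp
    _ ≤ X.ncard := Set.ncard_le_ncard (Set.range_subset_iff.mpr hFX) ((MLIJ_finite _ _).subset hX)

/-- Two solutions suffice for all top-`k` norms: everything on the fastest machine,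
or perfectly balanced loads. -/
theorem exists_topk_portfolio {d L s : ℕ} (hs : 1 ≤ s) (hd : 2 ≤ d) (g : Fin d → ℕ)
    (hgL : ∀ i, g i < L) (i₀ : Fin d) (hi₀ : g i₀ = 0)
    (hsum : ∀ f : ℕ → ℝ, ∑ i, f (g i) = ∑ j ∈ Finset.range L, ((s ^ (2 * j) : ℕ) : ℝ) * f j) :
    ∃ X : Set (Fin d → ℝ),
      X ⊆ MLIJ (fun i => (s : ℝ) ^ g i) (s ^ (2 * L) * ∑ j ∈ Finset.range L, s ^ j) ∧
      X.ncard = 2 ∧ ∀ k : ℕ, 1 ≤ k → k ≤ d →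
        ∀ y ∈ MLIJ (fun i => (s : ℝ) ^ g i) (s ^ (2 * L) * ∑ j ∈ Finset.range L, s ^ j),
          ∃ x ∈ X, topkNorm k x ≤ 1 * topkNorm k y := by
  have hs0 : (0 : ℝ) < s := by exact_mod_cast hs
  set Q := ∑ j ∈ Finset.range L, s ^ j with hQ
  have hL : 0 < L := (Nat.zero_le _).trans_lt (hgL i₀)
  have hQ1 : 0 < Q := Finset.sum_pos (fun j _ => by positivity) ⟨0, by simpa using hL⟩
  have hQsum : ∑ i, ((s : ℝ) ^ g i)⁻¹ = Q := by
    rw [hsum fun j => ((s : ℝ) ^ j)⁻¹, hQ]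
    push_cast
    refine Finset.sum_congr rfl fun j _ => ?_
    field_simp
    ring
  let x₁ : Fin d → ℝ := fun i => if i = i₀ then ((s ^ (2 * L) * Q : ℕ) : ℝ) else 0
  let x₂ : Fin d → ℝ := fun _ => (s : ℝ) ^ (2 * L)
  have hx₁ : x₁ ∈ MLIJ (fun i => (s : ℝ) ^ g i) (s ^ (2 * L) * Q) := by
    refine ⟨fun i => if i = i₀ then s ^ (2 * L) * Q else 0, by simp, fun i => ?_⟩
    by_cases h : i = i₀
    · simp [x₁, h, hi₀]
    · simp [x₁, h]
  have hx₂ : x₂ ∈ MLIJ (fun i => (s : ℝ) ^ g i) (s ^ (2 * L) * Q) := by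
    have hpow : ∀ i, (s : ℝ) ^ (2 * L - g i) * (s : ℝ) ^ g i = (s : ℝ) ^ (2 * L) := fun i => by
      rw [← pow_add]; congr 1; have := hgL i; omega
    refine ⟨fun i => s ^ (2 * L - g i), ?_, fun i => ?_⟩
    · rw [← @Nat.cast_inj ℝ]
      push_cast
      rw [← hQsum, Finset.mul_sum]
      refine Finset.sum_congr rfl fun i _ => ?_
      rw [← hpow i]
      field_simp
    · push_cast
      exact (hpow i).symm
  have hne : x₁ ≠ x₂ := by
    intro h
    have : Nontrivial (Fin d) := Fin.nontrivial_iff_two_le.mpr hd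
    obtain ⟨i, hi⟩ := exists_ne i₀
    have h1 := congrFun h i
    simp only [x₁, x₂, if_neg hi] at h1
    exact (pow_pos hs0 _).ne h1
  refine ⟨{x₁, x₂}, Set.insert_subset hx₁ (Set.singleton_subset_iff.mpr hx₂),
    Set.ncard_pair hne, ?_⟩
  rintro k hk hkd y ⟨m, hm, hy⟩
  have hn : ∑ i, |y i| * ((s : ℝ) ^ g i)⁻¹ = (s : ℝ) ^ (2 * L) * Q := by
    have : (s : ℝ) ^ (2 * L) * Q = ((∑ i, m i : ℕ) : ℝ) := by rw [hm]; push_cast; rfl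
    rw [this, Nat.cast_sum]
    refine Finset.sum_congr rfl fun i _ => ?_
    rw [hy, abs_of_nonneg (by positivity)]
    field_simp
  simp only [one_mul]
  rcases sum_mul_le_topkNorm hk hkd (fun i => ((s : ℝ) ^ g i)⁻¹) y (fun i => by positivity)
    (fun i => inv_le_one_of_one_le₀ (one_le_pow₀ (by exact_mod_cast hs))) with h | h
  · refine ⟨x₁, by simp, (topkNorm_le_sum k x₁).trans ?_⟩
    rw [hn] at h
    refine le_trans (le_of_eq ?_) h
    simp only [x₁, apply_ite abs, abs_zero, Finset.sum_ite_eq', Finset.mem_univ, if_true,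
      Nat.abs_cast]
    push_cast
    rfl
  · refine ⟨x₂, by simp, ?_⟩
    rw [topkNorm_const hkd (by positivity)]
    rw [hn, hQsum, ← mul_assoc] at h
    exact le_of_mul_le_mul_right h (by exact_mod_cast hQ1)

/-- Theorem: gap between portfolios for top-k norms and for ordered norms on MLIJ instances. -/
theorem stmt3 :
    ∃ K : ℝ, 1 ≤ K ∧
      ∀ β : ℝ, 1 ≤ β →
        ∃ c : ℝ, 0 < c ∧
          ∀ d₀ : ℕ, ∃ d : ℕ, d₀ ≤ d ∧
            ∃ (p : Fin d → ℝ) (n : ℕ), (∀ i, 0 < p i) ∧ 1 ≤ n ∧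
              (∃ X : Set (Fin d → ℝ), X ⊆ MLIJ p n ∧ X.ncard = 2 ∧
                ∀ k : ℕ, 1 ≤ k → k ≤ d →
                  ∀ y ∈ MLIJ p n, ∃ x ∈ X, topkNorm k x ≤ K * topkNorm k y) ∧
              (∀ X' : Set (Fin d → ℝ), X' ⊆ MLIJ p n →
                (∀ w : Fin d → ℝ, IsWeightVector w →
                  ∀ y ∈ MLIJ p n, ∃ x ∈ X', orderedNorm w x ≤ β * orderedNorm w y) →
                c * Real.log d / Real.log (Real.log d) ≤ (X'.ncard : ℝ)) := by
  refine ⟨1, le_rfl, fun β hβ => ?_⟩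
  obtain ⟨s, hs⟩ := exists_nat_ge (16 * β + 1)
  have hs2 : (17 : ℝ) ≤ s := by linarith
  have hs1 : 1 ≤ s := by
    have : (1 : ℝ) ≤ s := by linarith
    exact_mod_cast this
  have hlogs : 0 < Real.log s := Real.log_pos (by linarith)
  refine ⟨1 / (2 * Real.log s), by positivity, fun d₀ => ?_⟩
  set L := d₀ + 32 with hL
  obtain ⟨d, g, hgL, hsum⟩ := exists_grouping (fun j => s ^ (2 * j)) L
  have hd : d = ∑ j ∈ Finset.range L, s ^ (2 * j) := by
    have := hsum fun _ => 1
    simp only [Finset.sum_const, Finset.card_univ, Fintype.card_fin, nsmul_eq_mul, mul_one] at this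
    exact_mod_cast this
  have hLd : L ≤ d := by
    rw [hd]
    simpa using Finset.card_nsmul_le_sum (Finset.range L) (fun j => s ^ (2 * j)) 1
      fun j _ => Nat.one_le_pow _ _ hs1
  have hdu : d ≤ s ^ (2 * L) := by
    have hs' : 2 ≤ s ^ 2 := by
      have : 2 ≤ s := by
        have : (2 : ℝ) ≤ s := by linarith
        exact_mod_cast this
      nlinarith
    rw [hd, pow_mul]
    simp only [pow_mul]
    exact (Nat.geomSum_lt hs' fun j hj => Finset.mem_range.mp hj).le
  obtain ⟨i₀, hi₀⟩ : ∃ i₀, g i₀ = 0 := by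
    by_contra! h
    have h1 := hsum fun j => if j = 0 then 1 else 0
    simp [h, hL] at h1
  set Q := ∑ j ∈ Finset.range L, s ^ j with hQ
  have hQ1 : 1 ≤ Q :=
    Finset.sum_pos (fun j _ => Nat.pow_pos hs1) (Finset.nonempty_range_iff.mpr (by omega))
  refine ⟨d, by omega, fun i => (s : ℝ) ^ g i, s ^ (2 * L) * Q, fun i => by positivity,
    Nat.mul_pos (by positivity) hQ1,
    exists_topk_portfolio hs1 (by omega) g hgL i₀ hi₀ hsum, fun X' hX' hport => ?_⟩
  have hcard : (L : ℝ) ≤ X'.ncard := by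
    exact_mod_cast le_ncard_portfolio hβ hs (by omega) hQ1 g hsum X' hX' hport
  have hd32 : (32 : ℝ) ≤ d := by exact_mod_cast (show 32 ≤ d by omega)
  have hlogd : Real.exp 1 ≤ Real.log d := by
    have h1 : Real.log 32 ≤ Real.log d := Real.log_le_log (by norm_num) hd32
    have h2 : Real.log 32 = 5 * Real.log 2 := by
      rw [show (32 : ℝ) = 2 ^ 5 by norm_num, Real.log_pow]; norm_num
    linarith [Real.log_two_gt_d9, Real.exp_one_lt_d9]
  have hlogpos : 0 < Real.log d := (Real.exp_pos 1).trans_le hlogd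
  have hloglog : 1 ≤ Real.log (Real.log d) := (Real.le_log_iff_exp_le hlogpos).mpr hlogd
  have hup : Real.log d ≤ 2 * L * Real.log s := by
    have h1 : Real.log d ≤ Real.log ((s : ℝ) ^ (2 * L)) :=
      Real.log_le_log (by linarith) (by exact_mod_cast hdu)
    rw [Real.log_pow] at h1
    push_cast at h1
    exact_mod_cast h1
  calc 1 / (2 * Real.log s) * Real.log d / Real.log (Real.log d)
      ≤ 1 / (2 * Real.log s) * Real.log d := div_le_self (by positivity) hloglog
    _ ≤ L := by
        rw [one_div_mul_eq_div, div_le_iff₀ (by positivity)]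
        linarith
    _ ≤ X'.ncard := hcard
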